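/- arXiv:1901.08857 — 2 statements merged into one kernel-verified Lean document; each statement's English description precedes it below -/
import Mathlib

section
/- Let R be a closure-rule system on a set X, P a partial order on X, and Q* the least binary relation on X that contains P, is reflexive on X, is transitive, and is R-closed. Then P is feasible if and only if Q* is antisymmetric, and in that case the closure of P equals Q*. -/
/-- A partial order on a set `X`, represented as a set of ordered pairs:
reflexive on `X`, transitive, antisymmetric, and only relating elements of `X`. -/
def IsPartialOrderOn {α : Type*} (X : Set α) (P : Set (α × α)) : Prop :=
  P ⊆ X ×ˢ X ∧
  (∀ x ∈ X, (x, x) ∈ P) ∧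
  (∀ a b c : α, (a, b) ∈ P → (b, c) ∈ P → (a, c) ∈ P) ∧
  (∀ a b : α, (a, b) ∈ P → (b, a) ∈ P → a = b)

/-- A closure-rule system: a set of rules, each a finite set of hypothesis pairs
together with a conclusion pair. -/
def RClosed {α : Type*} (R : Set (Finset (α × α) × (α × α))) (Q : Set (α × α)) : Prop :=
  ∀ rule ∈ R, (↑rule.1 : Set (α × α)) ⊆ Q → rule.2 ∈ Q

/-- The rules of `R` only mention ordered pairs of elements of `X`. -/
def RulesOn {α : Type*} (X : Set α) (R : Set (Finset (α × α) × (α × α))) : Prop :=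
  ∀ rule ∈ R, (↑rule.1 : Set (α × α)) ⊆ X ×ˢ X ∧ rule.2 ∈ X ×ˢ X

/-- `C` is the closure of `P`: the smallest (under `⊆`) `R`-closed partial order on `X`
refining `P`. -/
def IsClosureOf {α : Type*} (R : Set (Finset (α × α) × (α × α))) (X : Set α)
    (P C : Set (α × α)) : Prop :=
  IsPartialOrderOn X C ∧ RClosed R C ∧ P ⊆ C ∧
  ∀ Q : Set (α × α), IsPartialOrderOn X Q → RClosed R Q → P ⊆ Q → C ⊆ Q

/-- `Q` contains `P`, is reflexive on `X`, is transitive, and is `R`-closed. -/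
def PreClosed {α : Type*} (X : Set α) (R : Set (Finset (α × α) × (α × α)))
    (P Q : Set (α × α)) : Prop :=
  P ⊆ Q ∧
  (∀ x ∈ X, (x, x) ∈ Q) ∧
  (∀ a b c : α, (a, b) ∈ Q → (b, c) ∈ Q → (a, c) ∈ Q) ∧
  RClosed R Q

/-- The full relation on `X` is pre-closed. -/
theorem preClosed_prod_self {α : Type*} {X : Set α} {R : Set (Finset (α × α) × (α × α))}
    {P : Set (α × α)} (hR : RulesOn X R) (hP : P ⊆ X ×ˢ X) : PreClosed X R P (X ×ˢ X) :=
  ⟨hP, fun _ hx => ⟨hx, hx⟩, fun _ _ _ hab hbc => ⟨hab.1, hbc.2⟩, fun rule hr _ => (hR rule hr).2⟩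

/-- An `R`-closed partial order refining `P` is pre-closed. -/
theorem IsPartialOrderOn.preClosed {α : Type*} {X : Set α} {R : Set (Finset (α × α) × (α × α))}
    {P Q : Set (α × α)} (hQ : IsPartialOrderOn X Q) (hRQ : RClosed R Q) (hPQ : P ⊆ Q) :
    PreClosed X R P Q :=
  ⟨hPQ, hQ.2.1, hQ.2.2.1, hRQ⟩

/-- `P` is feasible iff the least pre-closed relation `Q*` is antisymmetric,
and in that case `Q*` is the closure of `P`. -/
theorem feasible_iff_antisymm {α : Type*} (X : Set α)
    (R : Set (Finset (α × α) × (α × α))) (P Qstar : Set (α × α))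
    (hR : RulesOn X R) (hP : IsPartialOrderOn X P)
    (hQstar : PreClosed X R P Qstar ∧
      ∀ Q : Set (α × α), PreClosed X R P Q → Qstar ⊆ Q) :
    ((∃ C : Set (α × α), IsClosureOf R X P C) ↔
      (∀ a b : α, (a, b) ∈ Qstar → (b, a) ∈ Qstar → a = b)) ∧
    ((∀ a b : α, (a, b) ∈ Qstar → (b, a) ∈ Qstar → a = b) →
      IsClosureOf R X P Qstar) := by
  obtain ⟨⟨hPQ, hrefl, htrans, hclosed⟩, hleast⟩ := hQstar
  have hclosure (hanti : ∀ a b : α, (a, b) ∈ Qstar → (b, a) ∈ Qstar → a = b) :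
      IsClosureOf R X P Qstar :=
    ⟨⟨hleast _ (preClosed_prod_self hR hP.1), hrefl, htrans, hanti⟩, hclosed, hPQ,
      fun Q hQ hRQ hPQ' => hleast Q (hQ.preClosed hRQ hPQ')⟩
  refine ⟨⟨?_, fun hanti => ⟨Qstar, hclosure hanti⟩⟩, hclosure⟩
  rintro ⟨C, hC, hRC, hPC, -⟩ a b hab hba
  have hsub : Qstar ⊆ C := hleast C (hC.preClosed hRC hPC)
  exact hC.2.2.2 a b (hsub hab) (hsub hba)
end

section
/- Let R be a closure-rule system on a set X, let P be an R-closed partial order on X, and let e₁, e₂ ∈ X. Suppose there exists an R-closed partial order Q on X with Q ⊑ P and e₁ ≤_Q e₂. Then among all R-closed partial orders on X that refine P and order e₁ before e₂, there is a smallest one Q₀ (under ⊆); moreover Q₀ equals the least binary relation on X that contains P ∪ {(e₁, e₂)}, is reflexive on X, is transitive, and is R-closed. In other words, inserting the ordering (e₁, e₂) into a closed partial order and re-closing (the operation InsertAndClose) produces a closed partial order, namely the closure of P extended by (e₁, e₂). -/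
/-- The intersection of all pre-closed relations containing `P` is pre-closed. -/
theorem preClosed_sInter {α : Type*} (X : Set α) (R : Set (Finset (α × α) × (α × α)))
    (P : Set (α × α)) : PreClosed X R P (⋂₀ {Q : Set (α × α) | PreClosed X R P Q}) :=
  ⟨Set.subset_sInter fun _ hQ => hQ.1,
    fun x hx _ hQ => hQ.2.1 x hx,
    fun a b c hab hbc Q hQ => hQ.2.2.1 a b c (hab Q hQ) (hbc Q hQ),
    fun rule hrule hyp Q hQ => hQ.2.2.2 rule hrule fun _ hp => hyp hp Q hQ⟩

/-- A reflexive transitive relation contained in a partial order is a partial order. -/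
theorem IsPartialOrderOn.of_subset {α : Type*} {X : Set α} {P Q : Set (α × α)}
    (hQ : IsPartialOrderOn X Q) (hPQ : P ⊆ Q) (hrefl : ∀ x ∈ X, (x, x) ∈ P)
    (htrans : ∀ a b c : α, (a, b) ∈ P → (b, c) ∈ P → (a, c) ∈ P) :
    IsPartialOrderOn X P :=
  ⟨hPQ.trans hQ.1, hrefl, htrans, fun a b hab hba => hQ.2.2.2 a b (hPQ hab) (hPQ hba)⟩

/-- `InsertAndClose`: inserting an ordering `(e₁, e₂)` into a closed partial
order and re-closing yields the smallest closed partial order refining `P` and ordering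
`e₁` before `e₂`, which is the least pre-closed relation containing `P ∪ {(e₁, e₂)}`. -/
theorem insertAndClose {α : Type*} (X : Set α)
    (R : Set (Finset (α × α) × (α × α))) (P : Set (α × α))
    (hR : RulesOn X R) (hP : IsPartialOrderOn X P) (hPclosed : RClosed R P)
    (e₁ e₂ : α) (he₁ : e₁ ∈ X) (he₂ : e₂ ∈ X)
    (hfeas : ∃ Q : Set (α × α), IsPartialOrderOn X Q ∧ RClosed R Q ∧ P ⊆ Q ∧
      (e₁, e₂) ∈ Q) :
    ∃ Q₀ : Set (α × α),
      (IsPartialOrderOn X Q₀ ∧ RClosed R Q₀ ∧ P ⊆ Q₀ ∧ (e₁, e₂) ∈ Q₀) ∧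
      (∀ Q : Set (α × α), IsPartialOrderOn X Q → RClosed R Q → P ⊆ Q →
        (e₁, e₂) ∈ Q → Q₀ ⊆ Q) ∧
      Q₀ = ⋂₀ {Q : Set (α × α) | PreClosed X R (P ∪ {(e₁, e₂)}) Q} := by
  have hclosed : PreClosed X R (P ∪ {(e₁, e₂)})
      (⋂₀ {Q : Set (α × α) | PreClosed X R (P ∪ {(e₁, e₂)}) Q}) :=
    preClosed_sInter X R _
  have hleast : ∀ Q : Set (α × α), IsPartialOrderOn X Q → RClosed R Q → P ⊆ Q →
      (e₁, e₂) ∈ Q → ⋂₀ {Q : Set (α × α) | PreClosed X R (P ∪ {(e₁, e₂)}) Q} ⊆ Q :=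
    fun Q hQ hQR hPQ he => Set.sInter_subset_of_mem
      ⟨Set.union_subset hPQ (Set.singleton_subset_iff.2 he), hQ.2.1, hQ.2.2.1, hQR⟩
  obtain ⟨Q, hQ, hQR, hPQ, he⟩ := hfeas
  have hsub := hleast Q hQ hQR hPQ he
  obtain ⟨hext, hrefl, htrans, hrules⟩ := hclosed
  exact ⟨_, ⟨hQ.of_subset hsub hrefl htrans, hrules, Set.subset_union_left.trans hext,
    hext (Or.inr rfl)⟩, hleast, rfl⟩
end
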